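/- arXiv:2311.10204 — 2 statements merged into one kernel-verified Lean document; each statement's English description precedes it below -/
import Mathlib

section
/- Let G=(V,E) be a directed graph with edge coloring c:E→{1,2}, let s,t∈V, ℓ≥1 and c₁,…,c_ℓ∈{1,2}. Define the directed graph G' by adding new vertices u₁,…,u_ℓ to G and the edges (u_{i−1},u_i) for 1≤i≤ℓ, where u₀:=t. Label the edges of G' over the alphabet {(₁, )₁, (₂, )₂} by σ(u,v):=(_{c(u,v)} for every (u,v)∈E, and σ(u_{i−1},u_i):=)_{c_{ℓ+1−i}} for every 1≤i≤ℓ. Then there exists a walk from s to u_ℓ in G' spelling a word of the Dyck-2 language if and only if there exists a walk of length ℓ from s to t in G whose edge color sequence under c is c₁,…,c_ℓ. -/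
/-- `EdgeColoredWalk E c s t cs` : there is a walk `s = v₀, v₁, …, v_ℓ = t` in the
directed graph with edge relation `E` whose edge label sequence
`c v₀ v₁, …, c v_{ℓ-1} v_ℓ` equals `cs` (i.e., the walk spells the word `cs`). -/
inductive EdgeColoredWalk {V σ : Type*} (E : V → V → Prop) (c : V → V → σ) :
    V → V → List σ → Prop
  | nil (v : V) : EdgeColoredWalk E c v v []
  | cons {u v w : V} {a : σ} {cs : List σ} (he : E u v) (hc : c u v = a)
      (hw : EdgeColoredWalk E c v w cs) : EdgeColoredWalk E c u w (a :: cs)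

/-- The Dyck-2 language over the four-letter alphabet `Bool × Fin 2`, where
`(false, i)` is the opening parenthesis `(ᵢ` and `(true, i)` is the closing
parenthesis `)ᵢ`: generated by the grammar `S → SS`, `S → (ᵢ S )ᵢ`, `S → (ᵢ)ᵢ`. -/
inductive Dyck2 : List (Bool × Fin 2) → Prop
  | pair (i : Fin 2) : Dyck2 [(false, i), (true, i)]
  | wrap (i : Fin 2) {w : List (Bool × Fin 2)} (h : Dyck2 w) :
      Dyck2 ((false, i) :: (w ++ [(true, i)]))
  | concat {w₁ w₂ : List (Bool × Fin 2)} (h₁ : Dyck2 w₁) (h₂ : Dyck2 w₂) :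
      Dyck2 (w₁ ++ w₂)

/-- Run a pushdown recognizer on a word, starting from a given stack: opening parentheses are
pushed, closing ones must match the top of the stack. -/
def dyckRun : List (Fin 2) → List (Bool × Fin 2) → Option (List (Fin 2))
  | st, [] => some st
  | st, (false, i) :: w => dyckRun (i :: st) w
  | [], (true, _) :: _ => none
  | a :: st, (true, i) :: w => if a = i then dyckRun st w else none

theorem Dyck2.dyckRun_append {w : List (Bool × Fin 2)} (h : Dyck2 w) :
    ∀ st v, dyckRun st (w ++ v) = dyckRun st v := by
  induction h with
  | pair i => simp [dyckRun]
  | wrap i _ ih => simp [dyckRun, ih]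
  | concat _ _ ih₁ ih₂ => simp [ih₁, ih₂]

theorem dyckRun_map_open_append (ds : List (Fin 2)) (v : List (Bool × Fin 2)) :
    ∀ st, dyckRun st (ds.map (false, ·) ++ v) = dyckRun (ds.reverse ++ st) v := by
  induction ds with
  | nil => simp
  | cons a ds ih => simp [dyckRun, ih]

theorem eq_of_dyckRun_map_close (es : List (Fin 2)) :
    ∀ st, dyckRun st (es.map (true, ·)) = some [] → st = es := by
  induction es with
  | nil => simp [dyckRun]
  | cons a es ih =>
    rintro (_ | ⟨b, st⟩) h
    · simp [dyckRun] at h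
    · by_cases hb : b = a
      · rw [hb, ih st (by simpa [dyckRun, hb] using h)]
      · simp [dyckRun, hb] at h

theorem dyck2_map_open_append_map_close_reverse (cs : List (Fin 2)) (hne : cs ≠ []) :
    Dyck2 (cs.map (false, ·) ++ cs.reverse.map (true, ·)) := by
  induction cs with
  | nil => exact absurd rfl hne
  | cons a cs ih =>
    by_cases h : cs = []
    · subst h
      exact Dyck2.pair a
    · simpa using Dyck2.wrap a (ih h)

theorem Dyck2.eq_of_map_open_append_map_close_reverse {ds cs : List (Fin 2)}
    (h : Dyck2 (ds.map (false, ·) ++ cs.reverse.map (true, ·))) : ds = cs := by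
  have h₁ := h.dyckRun_append [] []
  rw [List.append_nil, dyckRun_map_open_append, List.append_nil] at h₁
  exact List.reverse_injective (eq_of_dyckRun_map_close _ _ h₁)

section Reduction

variable {V : Type*} (E : V → V → Prop) (c : V → V → Fin 2) (t : V) (cs : List (Fin 2))

/-- The edges of `G` together with a path `t → u₁ → ⋯ → u_ℓ` with `ℓ = cs.length`. -/
def pendantPathEdge (p q : V ⊕ ℕ) : Prop :=
  (∃ u v, p = .inl u ∧ q = .inl v ∧ E u v) ∨
  (p = .inl t ∧ q = .inr 1) ∨
  (∃ i, p = .inr i ∧ q = .inr (i + 1) ∧ 1 ≤ i ∧ i < cs.length)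

/-- Opening parentheses on `G`, and closing parentheses spelling `cs` backwards on the path. -/
def pendantPathLabel (p q : V ⊕ ℕ) : Bool × Fin 2 :=
  p.elim
    (fun u => q.elim (fun v => (false, c u v)) fun _ => (true, cs.getD (cs.length - 1) 0))
    (fun i => (true, cs.getD (cs.length - 1 - i) 0))

variable {cs}

theorem reverse_drop_eq_getD_cons {i : ℕ} (hi : i < cs.length) :
    cs.reverse.drop i = cs.getD (cs.length - 1 - i) 0 :: cs.reverse.drop (i + 1) := by
  rw [List.drop_eq_getElem_cons (by simpa using hi), List.getElem_reverse,
    List.getD_eq_getElem _ _ (by omega)]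

theorem reverse_eq_getD_cons (hne : cs ≠ []) :
    cs.reverse = cs.getD (cs.length - 1) 0 :: cs.reverse.drop 1 := by
  simpa using reverse_drop_eq_getD_cons (List.length_pos_iff.2 hne)

variable {E c t}

theorem word_of_pendantPath_walk (hne : cs ≠ []) {p q : V ⊕ ℕ} {w : List (Bool × Fin 2)}
    (h : EdgeColoredWalk (pendantPathEdge E t cs) (pendantPathLabel c cs) p q w)
    (hq : q = .inr cs.length) :
    (∀ v, p = .inl v → ∃ ds, EdgeColoredWalk E c v t ds ∧
      w = ds.map (false, ·) ++ cs.reverse.map (true, ·)) ∧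
    (∀ i, p = .inr i → w = (cs.reverse.drop i).map (true, ·)) := by
  induction h with
  | nil v =>
    subst hq
    refine ⟨by simp, fun i hi => ?_⟩
    obtain rfl := Sum.inr.inj hi
    simp
  | cons he hc _ ih =>
    obtain ⟨ih₁, ih₂⟩ := ih hq
    subst hc
    rcases he with ⟨u, v, rfl, rfl, he⟩ | ⟨rfl, rfl⟩ | ⟨i, rfl, rfl, -, hi⟩
    · refine ⟨fun u' hu => ?_, by simp⟩
      obtain rfl := Sum.inl.inj hu
      obtain ⟨ds, hds, rfl⟩ := ih₁ v rfl
      exact ⟨c u v :: ds, .cons he rfl hds, rfl⟩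
    · refine ⟨fun u' hu => ?_, by simp⟩
      obtain rfl := Sum.inl.inj hu
      refine ⟨[], .nil _, ?_⟩
      rw [ih₂ 1 rfl, reverse_eq_getD_cons hne]
      rfl
    · refine ⟨by simp, fun j hj => ?_⟩
      obtain rfl := Sum.inr.inj hj
      rw [ih₂ _ rfl, reverse_drop_eq_getD_cons hi]
      rfl

variable (E c t) in
theorem pendantPath_walk_inr {i : ℕ} (hi : i ≤ cs.length) (h1 : 1 ≤ i) :
    EdgeColoredWalk (pendantPathEdge E t cs) (pendantPathLabel c cs) (.inr i)
      (.inr cs.length) ((cs.reverse.drop i).map (true, ·)) := by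
  induction hi using Nat.decreasingInduction with
  | self =>
    rw [List.drop_eq_nil_of_le (by simp)]
    exact .nil _
  | of_succ i hi ih =>
    rw [reverse_drop_eq_getD_cons hi]
    exact .cons (.inr (.inr ⟨i, rfl, rfl, h1, hi⟩)) rfl (ih (by omega))

theorem EdgeColoredWalk.pendantPath_walk (hne : cs ≠ []) {s r : V} {ds : List (Fin 2)}
    (h : EdgeColoredWalk E c s r ds) (hr : r = t) :
    EdgeColoredWalk (pendantPathEdge E t cs) (pendantPathLabel c cs) (.inl s)
      (.inr cs.length) (ds.map (false, ·) ++ cs.reverse.map (true, ·)) := by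
  induction h with
  | nil v =>
    subst hr
    rw [reverse_eq_getD_cons hne]
    exact .cons (.inr (.inl ⟨rfl, rfl⟩)) rfl
      (pendantPath_walk_inr E c v (List.length_pos_iff.2 hne) le_rfl)
  | cons he hc _ ih =>
    subst hc
    exact .cons (.inl ⟨_, _, rfl, rfl, he⟩) rfl (ih hr)

end Reduction

/-- Let `G = (V, E)` be a directed graph with edge coloring
`c : E → {1,2}` (colors modeled by `Fin 2`), `s, t ∈ V`, and colors
`c₁, …, c_ℓ ∈ {1,2}` with `ℓ ≥ 1`. Form `G'` by adding new vertices `u₁, …, u_ℓ`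
(modeled as `Sum.inr 1, …, Sum.inr ℓ` in `V ⊕ ℕ`) and edges `(u_{i-1}, u_i)` for
`1 ≤ i ≤ ℓ` where `u₀ := t`. Label each edge `(u, v) ∈ E` by `(_{c(u,v)}` and each
path edge `(u_{i-1}, u_i)` by `)_{c_{ℓ+1-i}}`. Then there is a walk from `s` to
`u_ℓ` in `G'` spelling a word of the Dyck-2 language iff there is a walk of length
`ℓ` from `s` to `t` in `G` with edge color sequence `c₁, …, c_ℓ`. -/
theorem cfl_reachability_reduction {V : Type*} (E : V → V → Prop)
    (c : V → V → Fin 2) (s t : V) (cs : List (Fin 2)) (hne : cs ≠ []) :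
    (∃ w : List (Bool × Fin 2), Dyck2 w ∧
      EdgeColoredWalk
        (fun p q : V ⊕ ℕ =>
          (∃ u v, p = .inl u ∧ q = .inl v ∧ E u v) ∨
          (p = .inl t ∧ q = .inr 1) ∨
          (∃ i, p = .inr i ∧ q = .inr (i + 1) ∧ 1 ≤ i ∧ i < cs.length))
        (fun p q : V ⊕ ℕ =>
          match p, q with
          | .inl u, .inl v => (false, c u v)
          | .inl _, .inr _ => (true, cs.getD (cs.length - 1) 0)
          | .inr i, _ => (true, cs.getD (cs.length - 1 - i) 0))
        (.inl s) (.inr cs.length) w) ↔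
      EdgeColoredWalk E c s t cs := by
  have hlabel : (fun p q : V ⊕ ℕ =>
          match p, q with
          | .inl u, .inl v => (false, c u v)
          | .inl _, .inr _ => (true, cs.getD (cs.length - 1) 0)
          | .inr i, _ => (true, cs.getD (cs.length - 1 - i) 0)) = pendantPathLabel c cs := by
    funext p q
    rcases p with u | i <;> rcases q with v | j <;> rfl
  rw [hlabel]
  constructor
  · rintro ⟨w, hw, h⟩
    obtain ⟨ds, hds, rfl⟩ := (word_of_pendantPath_walk hne h rfl).1 s rfl
    exact hw.eq_of_map_open_append_map_close_reverse ▸ hds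
  · exact fun h => ⟨_, dyck2_map_open_append_map_close_reverse cs hne, h.pendantPath_walk hne rfl⟩
end

section
/- Let G=(V,E) be a directed graph with edge coloring c:E→{1,2} and s,t∈V. Define the directed graph G' by adding two new vertices s₀,s₁ to G, together with the edges (s₀,s₁) and (s₁,s₀) of color 1 and the edge (s₁,s) of color 2. Then for every L≥0, every ℓ∈ℕ and all colors c₁,…,c_ℓ∈{1,2}: there is a walk from s₀ to t in G' whose edge color sequence is 1^{2L+1} 2 c₁ c₂ … c_ℓ (that is, 2L+1 ones, followed by a 2, followed by c₁,…,c_ℓ) if and only if there is a walk of length ℓ from s to t in G whose edge color sequence under c is c₁,…,c_ℓ. -/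
theorem edgeColoredWalk_cons_iff {V σ : Type*} {E : V → V → Prop} {c : V → V → σ}
    {u w : V} {a : σ} {cs : List σ} :
    EdgeColoredWalk E c u w (a :: cs) ↔
      ∃ v, (E u v ∧ c u v = a) ∧ EdgeColoredWalk E c v w cs := by
  constructor
  · rintro (_ | ⟨he, hc, hw⟩)
    exact ⟨_, ⟨he, hc⟩, hw⟩
  · rintro ⟨v, ⟨he, hc⟩, hw⟩
    exact .cons he hc hw

/-- If `v` is the only vertex reached from `u` by an edge of color `a`, then a walk from `u`
whose first color is `a` is the same as a walk from `v` with the remaining colors. -/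
theorem edgeColoredWalk_cons_iff_of_forced {V σ : Type*} {E : V → V → Prop} {c : V → V → σ}
    {u v w : V} {a : σ} {cs : List σ} (h : ∀ q, E u q ∧ c u q = a ↔ q = v) :
    EdgeColoredWalk E c u w (a :: cs) ↔ EdgeColoredWalk E c v w cs := by
  simp [edgeColoredWalk_cons_iff, h]

/-- If the `a`-colored edges force `u → v` and `v → u`, an odd number of leading `a`s
leads from `u` to `v`. -/
theorem edgeColoredWalk_replicate_append_iff {V σ : Type*} {E : V → V → Prop}
    {c : V → V → σ} {u v w : V} {a : σ} {cs : List σ}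
    (huv : ∀ q, E u q ∧ c u q = a ↔ q = v) (hvu : ∀ q, E v q ∧ c v q = a ↔ q = u) (L : ℕ) :
    EdgeColoredWalk E c u w (List.replicate (2 * L + 1) a ++ cs) ↔
      EdgeColoredWalk E c v w cs := by
  induction L with
  | zero => exact edgeColoredWalk_cons_iff_of_forced huv
  | succ L ih =>
    rw [show 2 * (L + 1) + 1 = 2 * L + 1 + 1 + 1 by ring, List.replicate_succ,
      List.replicate_succ, List.cons_append, List.cons_append,
      edgeColoredWalk_cons_iff_of_forced huv, edgeColoredWalk_cons_iff_of_forced hvu, ih]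

/-- An embedding of colored graphs whose image has no outgoing edges preserves and reflects
colored walks. -/
theorem edgeColoredWalk_map_iff {V W σ : Type*} {E : V → V → Prop} {c : V → V → σ}
    {E' : W → W → Prop} {c' : W → W → σ} {f : V → W} (hf : Function.Injective f)
    (hE : ∀ u q, E' (f u) q ↔ ∃ v, q = f v ∧ E u v)
    (hc : ∀ u v, c' (f u) (f v) = c u v) {u w : V} {cs : List σ} :
    EdgeColoredWalk E' c' (f u) (f w) cs ↔ EdgeColoredWalk E c u w cs := by
  induction cs generalizing u with
  | nil =>
    constructor
    · intro h
      generalize hx : f u = x at h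
      generalize hy : f w = y at h
      cases h
      obtain rfl := hf (hx.trans hy.symm)
      exact .nil u
    · rintro ⟨⟩
      exact .nil _
  | cons a cs ih =>
    simp only [edgeColoredWalk_cons_iff, hE]
    constructor
    · rintro ⟨_, ⟨⟨v, rfl, he⟩, hv⟩, hw⟩
      exact ⟨v, ⟨he, (hc u v).symm.trans hv⟩, ih.1 hw⟩
    · rintro ⟨v, ⟨he, hv⟩, hw⟩
      exact ⟨f v, ⟨⟨v, rfl, he⟩, (hc u v).trans hv⟩, ih.2 hw⟩

/-- Let `G = (V, E)` be a directed graph with edge coloring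
`c : E → {1,2}` and `s, t ∈ V`. Form `G'` by adding two new vertices
`s₀` (= `Sum.inr false`) and `s₁` (= `Sum.inr true`) together with the edges
`(s₀, s₁)` and `(s₁, s₀)` of color `1` and the edge `(s₁, s)` of color `2`.
Then for every `L ≥ 0` and all colors `c₁, …, c_ℓ ∈ {1,2}`: there is a walk from
`s₀` to `t` in `G'` with edge color sequence `1^{2L+1} 2 c₁ c₂ … c_ℓ` iff there is a
walk of length `ℓ` from `s` to `t` in `G` with edge color sequence `c₁, …, c_ℓ`. -/
theorem length_padding {V : Type*} (E : V → V → Prop)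
    (c : V → V → ℕ) (hc : ∀ u v, E u v → c u v = 1 ∨ c u v = 2)
    (s t : V) (L : ℕ) (cs : List ℕ) (hcs : ∀ γ ∈ cs, γ = 1 ∨ γ = 2) :
    EdgeColoredWalk
        (fun p q : V ⊕ Bool =>
          (∃ u w, p = .inl u ∧ q = .inl w ∧ E u w) ∨
          (p = .inr false ∧ q = .inr true) ∨
          (p = .inr true ∧ q = .inr false) ∨
          (p = .inr true ∧ q = .inl s))
        (fun p q : V ⊕ Bool =>
          match p, q with
          | .inl u, .inl w => c u w
          | .inr true, .inl _ => 2
          | _, _ => 1)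
        (.inr false) (.inl t)
        (List.replicate (2 * L + 1) 1 ++ 2 :: cs) ↔
      EdgeColoredWalk E c s t cs := by
  rw [edgeColoredWalk_replicate_append_iff (v := .inr true),
    edgeColoredWalk_cons_iff_of_forced (v := .inl s),
    edgeColoredWalk_map_iff Sum.inl_injective]
  · simp
  · simp
  · rintro (q | _ | _) <;> simp
  · rintro (q | _ | _) <;> simp
  · rintro (q | _ | _) <;> simp
end
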